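/- arXiv:1805.12152 — 2 statements merged into one kernel-verified Lean document; each statement's English description precedes it below -/
import Mathlib

section
/- If the parametrized SVM solution has the form w₁·x₁ + v·z with z ~ N(4y, 1)·v contribution, unit norm constraint w₁² + v² = 1, and p ≤ 0.975, then the optimal solution satisfies v ≥ 1/√2. -/
open MeasureTheory ProbabilityTheory Real
open scoped ENNReal NNReal

noncomputable def signM : Measure ℝ :=
  (1/2 : ℝ≥0∞) • Measure.dirac (-1) + (1/2 : ℝ≥0∞) • Measure.dirac 1

noncomputable def flipM (p : ℝ) : Measure ℝ :=
  ENNReal.ofReal p • Measure.dirac 1 + ENNReal.ofReal (1 - p) • Measure.dirac (-1)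

/-- Reduced distribution on (y, x₁, z): y uniform on {±1}, x₁ = ±y with
probabilities p, 1-p, and the aggregated feature z ~ N(4y, 1). -/
noncomputable def paramD (p : ℝ) : Measure (ℝ × ℝ × ℝ) :=
  signM.bind fun y =>
    (((flipM p).map (fun s => s * y)).prod (gaussianReal (4 * y) 1)).map
      (fun xz => (y, xz.1, xz.2))

/-- Margin (hinge) loss of the parametrized linear classifier w₁·x₁ + v·z. -/
noncomputable def marginLoss (p w₁ v : ℝ) : ℝ :=
  ∫ ω, max 0 (1 - ω.1 * (w₁ * ω.2.1 + v * ω.2.2)) ∂(paramD p)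

noncomputable def hingeH (w v : ℝ) : ℝ :=
  ∫ z, max 0 (1 - (w + v * z)) ∂(gaussianReal 4 1)

lemma integrable_hinge (m a b : ℝ) :
    Integrable (fun z => max 0 (a + b * z)) (gaussianReal m 1) := by
  have h : Integrable (fun z : ℝ => z) (gaussianReal m 1) :=
    memLp_one_iff_integrable.1 (by
      have h := memLp_id_gaussianReal (μ := m) (v := 1) 1
      rw [ENNReal.coe_one] at h
      exact h)
  have h2 : Integrable (fun z : ℝ => a + b * z) (gaussianReal m 1) :=
    (integrable_const a).add (h.const_mul b)
  have := h2.pos_part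
  refine this.congr (Filter.Eventually.of_forall fun z => ?_)
  simp [max_comm]

lemma paramD_eq (p : ℝ) : paramD p =
    (1/2 : ℝ≥0∞) • (ENNReal.ofReal p • (gaussianReal (-4) 1).map (fun z => ((-1 : ℝ), (-1 : ℝ), z))
      + ENNReal.ofReal (1 - p) • (gaussianReal (-4) 1).map (fun z => ((-1 : ℝ), (1 : ℝ), z)))
    + (1/2 : ℝ≥0∞) • (ENNReal.ofReal p • (gaussianReal 4 1).map (fun z => ((1 : ℝ), (1 : ℝ), z))
      + ENNReal.ofReal (1 - p) • (gaussianReal 4 1).map (fun z => ((1 : ℝ), (-1 : ℝ), z))) := by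
  have key : ∀ f : ℝ → Measure (ℝ × ℝ × ℝ), signM.bind f
      = (1/2 : ℝ≥0∞) • f (-1) + (1/2 : ℝ≥0∞) • f 1 := by
    intro f
    ext s hs
    rw [Measure.bind_apply hs]
    · unfold signM
      simp [lintegral_add_measure, lintegral_smul_measure]
    · exact (aemeasurable_dirac.smul_measure _).add_measure (aemeasurable_dirac.smul_measure _)
  have key2 : ∀ y : ℝ, (((flipM p).map (fun s => s * y)).prod (gaussianReal (4 * y) 1)).map
      (fun xz => (y, xz.1, xz.2)) =
      ENNReal.ofReal p • (gaussianReal (4 * y) 1).map (fun z => (y, y, z))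
      + ENNReal.ofReal (1 - p) • (gaussianReal (4 * y) 1).map (fun z => (y, -y, z)) := by
    intro y
    have hm : Measurable (fun s : ℝ => s * y) := by fun_prop
    have hm2 : Measurable (fun xz : ℝ × ℝ => (y, xz.1, xz.2)) := by fun_prop
    unfold flipM
    rw [Measure.map_add _ _ hm, Measure.map_smul, Measure.map_smul, Measure.map_dirac' hm,
      Measure.map_dirac' hm, Measure.add_prod, Measure.prod_smul_left, Measure.prod_smul_left,
      Measure.dirac_prod, Measure.dirac_prod, Measure.map_add _ _ hm2, Measure.map_smul,
      Measure.map_smul, Measure.map_map hm2 (by fun_prop), Measure.map_map hm2 (by fun_prop)]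
    simp [Function.comp_def]
  unfold paramD
  rw [key, key2, key2]
  norm_num

lemma marginLoss_eq (p w v : ℝ) (hp : 0 ≤ p) (hp1 : p ≤ 1) :
    marginLoss p w v = p * hingeH w v + (1 - p) * hingeH (-w) v := by
  have hc : Continuous (fun ω : ℝ × ℝ × ℝ => max 0 (1 - ω.1 * (w * ω.2.1 + v * ω.2.2))) := by
    fun_prop
  have hI : ∀ m a b : ℝ, Integrable
      (fun ω : ℝ × ℝ × ℝ => max 0 (1 - ω.1 * (w * ω.2.1 + v * ω.2.2)))
      ((gaussianReal m 1).map (fun z => (a, b, z))) := by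
    intro m a b
    rw [integrable_map_measure hc.aestronglyMeasurable (by fun_prop)]
    refine (integrable_hinge m (1 - a * (w * b)) (-(a * v))).congr
      (Filter.Eventually.of_forall fun z => ?_)
    simp only [Function.comp]
    congr 1; ring
  have hV : ∀ m a b : ℝ, ∫ ω, max 0 (1 - ω.1 * (w * ω.2.1 + v * ω.2.2))
      ∂((gaussianReal m 1).map (fun z => (a, b, z)))
      = ∫ z, max 0 (1 - a * (w * b + v * z)) ∂(gaussianReal m 1) := by
    intro m a b
    rw [integral_map (by fun_prop) hc.aestronglyMeasurable]
  have hneg : ∀ f : ℝ → ℝ, Continuous f → ∫ z, f z ∂(gaussianReal (-4) 1)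
      = ∫ z, f (-z) ∂(gaussianReal 4 1) := by
    intro f hf
    rw [← gaussianReal_map_neg, integral_map (by fun_prop) hf.aestronglyMeasurable]
  have hs : ∀ (c : ℝ) m a b, Integrable
      (fun ω : ℝ × ℝ × ℝ => max 0 (1 - ω.1 * (w * ω.2.1 + v * ω.2.2)))
      (ENNReal.ofReal c • (gaussianReal m 1).map (fun z => (a, b, z))) :=
    fun c m a b => (hI m a b).smul_measure ENNReal.ofReal_ne_top
  unfold marginLoss
  rw [paramD_eq, integral_add_measure
    (((hs _ _ _ _).add_measure (hs _ _ _ _)).smul_measure (by simp))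
    (((hs _ _ _ _).add_measure (hs _ _ _ _)).smul_measure (by simp)),
    integral_smul_measure, integral_smul_measure,
    integral_add_measure (hs _ _ _ _) (hs _ _ _ _),
    integral_add_measure (hs _ _ _ _) (hs _ _ _ _)]
  simp only [integral_smul_measure, hV]
  rw [hneg _ (by fun_prop), hneg _ (by fun_prop)]
  rw [ENNReal.toReal_ofReal hp, ENNReal.toReal_ofReal (by linarith)]
  have e1 : ∫ z, max 0 (1 - (-1) * (w * (-1) + v * -z)) ∂(gaussianReal 4 1) = hingeH w v := by
    unfold hingeH; congr 1; ext z; congr 1; ring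
  have e2 : ∫ z, max 0 (1 - (-1) * (w * 1 + v * -z)) ∂(gaussianReal 4 1) = hingeH (-w) v := by
    unfold hingeH; congr 1; ext z; congr 1; ring
  have e3 : ∫ z, max 0 (1 - 1 * (w * 1 + v * z)) ∂(gaussianReal 4 1) = hingeH w v := by
    unfold hingeH; congr 1; ext z; congr 1; ring
  have e4 : ∫ z, max 0 (1 - 1 * (w * (-1) + v * z)) ∂(gaussianReal 4 1) = hingeH (-w) v := by
    unfold hingeH; congr 1; ext z; congr 1; ring
  rw [e1, e2, e3, e4]
  simp
  ring

lemma hingeH_nonneg (w v : ℝ) : 0 ≤ hingeH w v :=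
  integral_nonneg fun _ => le_max_left _ _

lemma integral_mul_exp (a : ℝ) (ha : 0 < a) :
    ∫ t in Set.Ioi (0:ℝ), t * exp (-(a * t)) = 1 / a ^ 2 := by
  have h := Real.integral_rpow_mul_exp_neg_mul_Ioi (a := 2) (r := a) (by norm_num) ha
  have h2 : Gamma 2 = 1 := Real.Gamma_two
  rw [h2] at h
  norm_num at h
  rw [h]; simp

/-- Upper bound: with `t = (1-w)/v`, `a = 4 - t`. -/
lemma hingeH_upper (v t a : ℝ) (hv : 0 < v) (ha : 0 < a) (hat : a = 4 - t) :
    hingeH (1 - v * t) v ≤ (√(2 * π))⁻¹ * (v * exp (-a ^ 2 / 2) / a ^ 2) := by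
  unfold hingeH
  rw [integral_gaussianReal_eq_integral_smul one_ne_zero]
  set F : ℝ → ℝ := Set.indicator (Set.Ioi 0) (fun u => u * exp (-(a * u))) with hF
  have hFint : ∫ u, F u = 1 / a ^ 2 := by
    rw [hF, integral_indicator measurableSet_Ioi, integral_mul_exp a ha]
  have hFi : Integrable F := by
    apply Integrable.of_integral_ne_zero
    rw [hFint]; positivity
  have h1 : ∫ z, (√(2 * π))⁻¹ * (v * exp (-a ^ 2 / 2)) * F (t - z)
      = (√(2 * π))⁻¹ * (v * exp (-a ^ 2 / 2) / a ^ 2) := by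
    rw [integral_const_mul, integral_sub_left_eq_self F volume t, hFint]; ring
  rw [← h1]
  apply integral_mono_of_nonneg
  · refine Filter.Eventually.of_forall fun z => ?_
    exact smul_nonneg (gaussianPDFReal_nonneg _ _ _) (le_max_left _ _)
  · exact (hFi.comp_sub_left t).const_mul _
  · refine Filter.Eventually.of_forall fun z => ?_
    simp only [smul_eq_mul, gaussianPDFReal, NNReal.coe_one, mul_one]
    by_cases hz : 0 < t - z
    · have : F (t - z) = (t - z) * exp (-(a * (t - z))) := by
        rw [hF, Set.indicator_of_mem (Set.mem_Ioi.2 hz)]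
      rw [this]
      have hm : max 0 (1 - (1 - v * t + v * z)) = v * (t - z) := by
        rw [max_eq_right] <;> nlinarith
      rw [hm]
      have he : exp (-(z - 4) ^ 2 / 2) ≤ exp (-a ^ 2 / 2) * exp (-(a * (t - z))) := by
        rw [← Real.exp_add]
        apply Real.exp_le_exp.2
        rw [hat]; nlinarith [sq_nonneg (t - z)]
      calc (√(2 * π))⁻¹ * exp (-(z - 4) ^ 2 / 2) * (v * (t - z))
          ≤ (√(2 * π))⁻¹ * (exp (-a ^ 2 / 2) * exp (-(a * (t - z)))) * (v * (t - z)) := by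
            gcongr
        _ = _ := by ring
    · have : F (t - z) = 0 := by
        rw [hF, Set.indicator_of_notMem (by simpa using hz)]
      rw [this]
      have hm : max 0 (1 - (1 - v * t + v * z)) = 0 := by
        rw [max_eq_left]; nlinarith
      rw [hm]; simp

lemma hingeH_lower (w v : ℝ)
    (h : ∀ z : ℝ, 1.41 ≤ z → z ≤ 2.41 → 0.7 * (2.41 - z) ≤ 1 - (w + v * z)) :
    (√(2 * π))⁻¹ * (exp (-(5/2)) * 0.32) ≤ hingeH w v := by
  unfold hingeH
  set g : ℝ → ℝ := Set.indicator (Set.Ioc 1.41 2.41) (fun z => 0.7 * (2.41 - z)) with hg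
  have h1 : ∫ z, g z ∂(gaussianReal 4 1) ≤ ∫ z, max 0 (1 - (w + v * z)) ∂(gaussianReal 4 1) := by
    apply integral_mono_of_nonneg
    · refine Filter.Eventually.of_forall fun z => ?_
      refine Set.indicator_nonneg (fun z hz => ?_) z
      have := hz.2
      show (0:ℝ) ≤ 0.7 * (2.41 - z)
      nlinarith
    · refine (integrable_hinge 4 (1 - w) (-v)).congr (Filter.Eventually.of_forall fun z => ?_)
      show max 0 (1 - w + -v * z) = max 0 (1 - (w + v * z))
      congr 1; ring
    · refine Filter.Eventually.of_forall fun z => ?_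
      by_cases hz : z ∈ Set.Ioc (1.41 : ℝ) 2.41
      · simp only [hg, Set.indicator_of_mem hz]
        exact (h z hz.1.le hz.2).trans (le_max_right _ _)
      · simp only [hg, Set.indicator_of_notMem hz]
        exact le_max_left _ _
  refine le_trans ?_ h1
  rw [integral_gaussianReal_eq_integral_smul one_ne_zero]
  have h2 : ∀ z, gaussianPDFReal 4 1 z • g z =
      Set.indicator (Set.Ioc (1.41:ℝ) 2.41)
        (fun z => (√(2 * π))⁻¹ * exp (-(z - 4) ^ 2 / 2) * (0.7 * (2.41 - z))) z := by
    intro z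
    by_cases hz : z ∈ Set.Ioc (1.41 : ℝ) 2.41
    · simp only [hg, Set.indicator_of_mem hz]
      simp [gaussianPDFReal]
    · simp only [hg, Set.indicator_of_notMem hz]; simp
  simp_rw [h2]
  rw [integral_indicator measurableSet_Ioc, ← intervalIntegral.integral_of_le (by norm_num)]
  have h3 : ∫ z in (1.41:ℝ)..2.41,
      (√(2 * π))⁻¹ * exp (-(5/2)) * ((0.7 * (2.41 - z)) * (7/2 - (z - 4)^2 / 2))
      ≤ ∫ z in (1.41:ℝ)..2.41, (√(2 * π))⁻¹ * exp (-(z - 4) ^ 2 / 2) * (0.7 * (2.41 - z)) := by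
    apply intervalIntegral.integral_mono_on (by norm_num)
    · exact Continuous.intervalIntegrable (by fun_prop) _ _
    · exact Continuous.intervalIntegrable (by fun_prop) _ _
    · intro z hz
      have hz2 : 0 ≤ 0.7 * (2.41 - z) := by have := hz.2; nlinarith
      have he : exp (-(5/2)) * (7/2 - (z - 4)^2 / 2) ≤ exp (-(z - 4) ^ 2 / 2) := by
        have : exp (-(z - 4) ^ 2 / 2) = exp (-(5/2)) * exp (5/2 - (z-4)^2/2) := by
          rw [← Real.exp_add]; congr 1; ring
        rw [this]
        gcongr
        have := Real.add_one_le_exp (5/2 - (z-4)^2/2)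
        linarith
      calc (√(2 * π))⁻¹ * exp (-(5/2)) * ((0.7 * (2.41 - z)) * (7/2 - (z - 4)^2 / 2))
          = (√(2 * π))⁻¹ * (exp (-(5/2)) * (7/2 - (z - 4)^2 / 2)) * (0.7 * (2.41 - z)) := by ring
        _ ≤ _ := by gcongr
  refine le_trans ?_ h3
  rw [intervalIntegral.integral_const_mul, mul_assoc]
  have h4 : (0.32 : ℝ) ≤ ∫ z in (1.41:ℝ)..2.41, (0.7 * (2.41 - z)) * (7/2 - (z - 4)^2 / 2) := by
    have hd : ∀ x ∈ Set.uIcc (1.41:ℝ) 2.41, HasDerivAt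
        (fun z : ℝ => 0.7 * (-10.845 * z + (14.14/2) * z^2 - (5.205/3) * z^3 + z^4/8))
        ((0.7 * (2.41 - x)) * (7/2 - (x - 4)^2 / 2)) x := by
      intro x _
      have := ((((hasDerivAt_id x).const_mul (-10.845)).add
        (((hasDerivAt_pow 2 x)).const_mul (14.14/2))).sub
        ((hasDerivAt_pow 3 x).const_mul (5.205/3))).add ((hasDerivAt_pow 4 x).div_const 8)
      refine (this.const_mul 0.7).congr_deriv ?_
      norm_num
      ring
    rw [intervalIntegral.integral_eq_sub_of_hasDerivAt hd
      (Continuous.intervalIntegrable (by fun_prop) _ _)]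
    norm_num
  gcongr

lemma exp_neg_one_lt : exp (-1) < 0.36788 := by
  have := Real.exp_neg_one_lt_d9
  linarith

/-- If p ≤ 0.975, any unit-norm minimizer (w₁, v) of the margin loss
satisfies v ≥ 1/√2. -/
theorem svm_weight_on_aggregate (p w₁ v : ℝ)
    (hp : 1/2 ≤ p) (hp1 : p ≤ 0.975)
    (hnorm : w₁ ^ 2 + v ^ 2 = 1)
    (hopt : ∀ w₁' v' : ℝ, w₁' ^ 2 + v' ^ 2 = 1 →
      marginLoss p w₁ v ≤ marginLoss p w₁' v') :
    1 / Real.sqrt 2 ≤ v := by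
  have hpos : (0:ℝ) < (√(2 * π))⁻¹ := by positivity
  by_contra hv
  push Not at hv
  set s : ℝ := 1 / √2 with hs
  have hs2 : s ^ 2 = 1 / 2 := by
    rw [hs, div_pow, Real.sq_sqrt (by norm_num)]; norm_num
  have hs0 : 0 < s := by positivity
  have hs7 : 0.707 < s := by nlinarith
  have hs8 : s < 0.7072 := by nlinarith
  have hlow : (√(2 * π))⁻¹ * (exp (-(5/2)) * 0.32) ≤ hingeH (-|w₁|) v := by
    apply hingeH_lower
    intro z hz1 hz2
    have hw : 0 ≤ |w₁| := abs_nonneg _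
    have hw2 : |w₁| ^ 2 = w₁ ^ 2 := sq_abs _
    by_cases hv0 : 0 ≤ v
    · have : s ≤ |w₁| := by
        by_contra hc
        push Not at hc
        nlinarith
      have : v * z ≤ s * z := by nlinarith
      nlinarith
    · push Not at hv0
      nlinarith
  have hL : (1 - p) * ((√(2 * π))⁻¹ * (exp (-(5/2)) * 0.32)) ≤ marginLoss p w₁ v := by
    rw [marginLoss_eq p w₁ v (by linarith) (by linarith)]
    have n1 := hingeH_nonneg w₁ v
    have n2 := hingeH_nonneg (-w₁) v
    have n3 := hingeH_nonneg (-|w₁|) v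
    rcases le_total 0 w₁ with h | h
    · rw [abs_of_nonneg h] at hlow
      nlinarith
    · rw [abs_of_nonpos h, neg_neg] at hlow
      nlinarith
  have hU := hopt (7/25) (24/25) (by norm_num)
  rw [marginLoss_eq p (7/25) (24/25) (by linarith) (by linarith)] at hU
  have u1 := hingeH_upper (24/25) (3/4) (13/4) (by norm_num) (by norm_num) (by norm_num)
  have u2 := hingeH_upper (24/25) (4/3) (8/3) (by norm_num) (by norm_num) (by norm_num)
  rw [show (1 - 24/25 * (3/4) : ℝ) = 7/25 by norm_num] at u1
  rw [show (1 - 24/25 * (4/3) : ℝ) = -(7/25) by norm_num] at u2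
  have ex1 : exp (-(13/4)^2/2) ≤ exp (-(5/2)) * (1/16) := by
    have h16 : (1/16 : ℝ) = exp (-(4 * Real.log 2)) := by
      rw [Real.exp_neg, show 4 * Real.log 2 = Real.log (2^4) by rw [Real.log_pow]; norm_num,
        Real.exp_log (by norm_num)]
      norm_num
    rw [h16, ← Real.exp_add]
    apply Real.exp_le_exp.2
    have := Real.log_two_lt_d9
    linarith
  have ex2 : exp (-(8/3)^2/2) ≤ exp (-(5/2)) * 0.36788 := by
    have : exp (-(8/3)^2/2) ≤ exp (-(5/2)) * exp (-1) := by
      rw [← Real.exp_add]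
      apply Real.exp_le_exp.2
      norm_num
    nlinarith [exp_neg_one_lt, Real.exp_pos (-(5/2))]
  have hE := Real.exp_pos (-(5/2))
  set C := (√(2 * π))⁻¹
  set E := exp (-(5/2))
  have hCE : 0 < C * E := by positivity
  have u1' : hingeH (7/25) (24/25) ≤ C * E * 0.0057 := by
    refine u1.trans ?_
    rw [mul_assoc]
    apply mul_le_mul_of_nonneg_left _ hpos.le
    rw [div_le_iff₀ (by norm_num)]
    linarith
  have u2' : hingeH (-(7/25)) (24/25) ≤ C * E * 0.0498 := by
    refine u2.trans ?_
    rw [mul_assoc]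
    apply mul_le_mul_of_nonneg_left _ hpos.le
    rw [div_le_iff₀ (by norm_num)]
    linarith
  have a1 : p * hingeH (7/25) (24/25) ≤ p * (C * E * 0.0057) := by gcongr
  have a2 : (1 - p) * hingeH (-(7/25)) (24/25) ≤ (1 - p) * (C * E * 0.0498) := by
    apply mul_le_mul_of_nonneg_left u2'; linarith
  have fin : (1 - p) * (C * (E * 0.32)) ≤ p * (C * E * 0.0057) + (1 - p) * (C * E * 0.0498) := by
    linarith
  have : C * E * ((1 - p) * 0.32 - p * 0.0057 - (1 - p) * 0.0498) ≤ 0 := by linarith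
  have h5 : 0 < (1 - p) * 0.32 - p * 0.0057 - (1 - p) * 0.0498 := by linarith
  have := mul_pos hCE h5
  linarith
end

section
/- Any minimizer of the adversarial SVM objective E[max(0, 1 - y wᵀx + ε‖w‖₁)] + (λ/2)‖w‖₂² on the distribution D with ε ≥ 2η assigns weight 0 to every coordinate i ≥ 2. -/
open MeasureTheory ProbabilityTheory Real
open scoped ENNReal NNReal

noncomputable def dataD (p η : ℝ) (d : ℕ) : Measure ((ℝ × (Fin d → ℝ)) × ℝ) :=
  signM.bind fun y =>
    (((flipM p).map (fun s => s * y)).prod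
      (Measure.pi fun _ : Fin d => gaussianReal (η * y) 1)).map (fun x => (x, y))

/-- The adversarial soft-margin SVM objective
E[max(0, 1 - y wᵀx + ε‖w‖₁)] + (λ/2)‖w‖₂² over D. -/
noncomputable def advSvmObj (p η ε lam : ℝ) (d : ℕ) (w : ℝ × (Fin d → ℝ)) : ℝ :=
  (∫ ω, max 0 (1 - ω.2 * (w.1 * ω.1.1 + ∑ i, w.2 i * ω.1.2 i)
      + ε * (|w.1| + ∑ i, |w.2 i|)) ∂(dataD p η d))
    + lam / 2 * (w.1 ^ 2 + ∑ i, (w.2 i) ^ 2)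

lemma svm_bind_eq {β : Type*} [MeasurableSpace β] (f : ℝ → Measure β) :
    signM.bind f = (1/2 : ℝ≥0∞) • f (-1) + (1/2 : ℝ≥0∞) • f 1 := by
  have hf : AEMeasurable f signM := by
    unfold signM
    exact (aemeasurable_dirac.smul_measure _).add_measure (aemeasurable_dirac.smul_measure _)
  ext s hs
  rw [Measure.bind_apply hs hf]
  unfold signM
  rw [lintegral_add_measure, lintegral_smul_measure, lintegral_smul_measure, lintegral_dirac,
    lintegral_dirac]
  simp

noncomputable def svmNu (p η : ℝ) (d : ℕ) (y : ℝ) : Measure ((ℝ × (Fin d → ℝ)) × ℝ) :=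
    (((flipM p).map (fun s => s * y)).prod
      (Measure.pi fun _ : Fin d => gaussianReal (η * y) 1)).map (fun x => (x, y))

noncomputable def svmLoss (ε : ℝ) (d : ℕ) (w : ℝ × (Fin d → ℝ))
    (ω : (ℝ × (Fin d → ℝ)) × ℝ) : ℝ :=
  max 0 (1 - ω.2 * (w.1 * ω.1.1 + ∑ i, w.2 i * ω.1.2 i) + ε * (|w.1| + ∑ i, |w.2 i|))

lemma svmLoss_meas (ε : ℝ) (d : ℕ) (w : ℝ × (Fin d → ℝ)) : Measurable (svmLoss ε d w) := by
  unfold svmLoss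
  fun_prop

instance svm_flip_fin (p : ℝ) : IsFiniteMeasure (flipM p) := by
  unfold flipM
  constructor
  simp

lemma svm_flip_int (p y : ℝ) : Integrable (fun x : ℝ => x) ((flipM p).map (fun s => s * y)) := by
  rw [integrable_map_measure (by fun_prop) (by fun_prop)]
  unfold flipM
  refine Integrable.add_measure ?_ ?_ <;>
  · refine Integrable.smul_measure ?_ ENNReal.ofReal_ne_top
    exact integrable_dirac (by simp)

lemma svm_gauss_int (m : ℝ) (d : ℕ) (i : Fin d) :
    Integrable (fun x : Fin d → ℝ => x i) (Measure.pi fun _ : Fin d => gaussianReal m 1) := by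
  have h : Integrable (fun x : ℝ => x) (gaussianReal m 1) :=
    (memLp_id_gaussianReal 1).integrable le_rfl
  exact integrable_comp_eval (μ := fun _ : Fin d => gaussianReal m 1) (i := i) h

lemma svm_gauss_mean (m : ℝ) (d : ℕ) (i : Fin d) :
    ∫ x : Fin d → ℝ, x i ∂(Measure.pi fun _ : Fin d => gaussianReal m 1) = m := by
  have := integral_comp_eval (μ := fun _ : Fin d => gaussianReal m 1) (i := i)
    (f := fun x : ℝ => x) (by fun_prop)
  rw [this, integral_id_gaussianReal]

lemma svmLoss_int (p η ε : ℝ) (d : ℕ) (y : ℝ) (w : ℝ × (Fin d → ℝ)) :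
    Integrable (svmLoss ε d w) (svmNu p η d y) := by
  unfold svmNu
  rw [integrable_map_measure (svmLoss_meas ε d w).aestronglyMeasurable (by fun_prop)]
  unfold svmLoss
  refine Integrable.sup (integrable_const 0) ?_
  refine Integrable.add (Integrable.sub (integrable_const 1) (Integrable.const_mul
    (Integrable.add ?_ ?_) y)) (integrable_const _)
  · exact ((svm_flip_int p y).comp_fst _).const_mul _
  · refine integrable_finsetSum _ fun i _ => ?_
    exact ((svm_gauss_int (η * y) d i).comp_snd _).const_mul _

lemma svm_cond (p η ε : ℝ) (d : ℕ) (y : ℝ) (hy : y * y = 1) (hη : 0 < η) (hε : 2 * η ≤ ε)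
    (w : ℝ × (Fin d → ℝ)) :
    ∫ ω, svmLoss ε d (w.1, 0) ω ∂(svmNu p η d y) ≤ ∫ ω, svmLoss ε d w ω ∂(svmNu p η d y) := by
  have i1 := svmLoss_int p η ε d y w
  have i0 := svmLoss_int p η ε d y (w.1, 0)
  unfold svmNu at *
  have hm : Measurable (fun x : ℝ × (Fin d → ℝ) => (x, y)) := by fun_prop
  rw [integral_map hm.aemeasurable (svmLoss_meas ε d _).aestronglyMeasurable,
    integral_map hm.aemeasurable (svmLoss_meas ε d _).aestronglyMeasurable]
  rw [integrable_map_measure (svmLoss_meas ε d _).aestronglyMeasurable hm.aemeasurable] at i0 i1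
  set ρ := (flipM p).map (fun s => s * y) with hρ
  set π' := Measure.pi fun _ : Fin d => gaussianReal (η * y) 1 with hπ
  let A : ℝ → ℝ := fun t => 1 - y * (w.1 * t) + ε * |w.1|
  let g : ℝ → ℝ := fun t => if 0 < A t then 1 else 0
  let S : (Fin d → ℝ) → ℝ := fun x => ∑ i, (ε * |w.2 i| - y * w.2 i * x i)
  have hA : Measurable A := by fun_prop
  have hg : Measurable g := Measurable.ite (measurableSet_lt measurable_const hA)
    measurable_const measurable_const
  have hg0 : ∀ t, 0 ≤ g t := fun t => by dsimp only [g]; split_ifs <;> norm_num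
  have hSt : ∀ i, Integrable (fun x : Fin d → ℝ => ε * |w.2 i| - y * w.2 i * x i) π' :=
    fun i => (integrable_const _).sub ((svm_gauss_int (η * y) d i).const_mul _)
  have hSi : Integrable S π' := integrable_finsetSum _ fun i _ => hSt i
  have hgi : Integrable g ρ := by
    refine Integrable.of_bound hg.aestronglyMeasurable 1 (Filter.Eventually.of_forall fun t => ?_)
    dsimp only [g]; split_ifs <;> norm_num
  have hS0 : 0 ≤ ∫ x, S x ∂π' := by
    rw [integral_finsetSum _ fun i _ => hSt i]
    refine Finset.sum_nonneg fun i _ => ?_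
    rw [integral_sub (integrable_const _) ((svm_gauss_int (η * y) d i).const_mul _),
      integral_const_mul (y * w.2 i), svm_gauss_mean]
    simp only [integral_const, probReal_univ, one_smul, smul_eq_mul, one_mul]
    have : y * w.2 i * (η * y) = η * w.2 i := by linear_combination (η * w.2 i) * hy
    rw [this]
    nlinarith [le_abs_self (w.2 i), abs_nonneg (w.2 i)]
  have hprod : 0 ≤ ∫ z, g z.1 * S z.2 ∂(ρ.prod π') := by
    rw [integral_prod_mul]
    exact mul_nonneg (integral_nonneg hg0) hS0
  have hpt : ∀ z : ℝ × (Fin d → ℝ),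
      svmLoss ε d (w.1, 0) (z, y) + g z.1 * S z.2 ≤ svmLoss ε d w (z, y) := by
    intro z
    have e0 : svmLoss ε d (w.1, 0) (z, y) = max 0 (A z.1) := by simp [svmLoss, A]
    have e1 : svmLoss ε d w (z, y) = max 0 (A z.1 + S z.2) := by
      simp only [svmLoss, A, S, Finset.sum_sub_distrib, mul_assoc, ← Finset.mul_sum]
      congr 1; ring
    rw [e0, e1]
    dsimp only [g]
    split_ifs with h
    · rw [max_eq_right h.le, one_mul]; exact le_max_right _ _
    · rw [max_eq_left (not_lt.mp h)]; simp
  have hgS : Integrable (fun z : ℝ × (Fin d → ℝ) => g z.1 * S z.2) (ρ.prod π') :=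
    hgi.mul_prod hSi
  have := integral_mono (i0.add hgS) i1 hpt
  have h2 := integral_add i0 hgS
  simp only [Function.comp_def, Pi.add_apply] at *
  linarith

lemma svm_obj_eq (p η ε lam : ℝ) (d : ℕ) (w : ℝ × (Fin d → ℝ)) :
    advSvmObj p η ε lam d w = 1/2 * (∫ ω, svmLoss ε d w ω ∂(svmNu p η d (-1)))
      + 1/2 * (∫ ω, svmLoss ε d w ω ∂(svmNu p η d 1))
      + lam / 2 * (w.1 ^ 2 + ∑ i, (w.2 i) ^ 2) := by
  have hD : dataD p η d = (1/2 : ℝ≥0∞) • svmNu p η d (-1) + (1/2 : ℝ≥0∞) • svmNu p η d 1 :=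
    svm_bind_eq (svmNu p η d)
  have hobj : advSvmObj p η ε lam d w = (∫ ω, svmLoss ε d w ω ∂(dataD p η d))
    + lam / 2 * (w.1 ^ 2 + ∑ i, (w.2 i) ^ 2) := rfl
  rw [hobj, hD, integral_add_measure ((svmLoss_int p η ε d _ w).smul_measure (by simp))
    ((svmLoss_int p η ε d _ w).smul_measure (by simp)), integral_smul_measure,
    integral_smul_measure]
  simp

/-- With ε ≥ 2η, any minimizer of the adversarial SVM objective on D assigns
zero weight to every weakly correlated feature xᵢ, i ≥ 2. -/
theorem adversarial_svm_zero_weights (p η ε lam : ℝ) (d : ℕ)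
    (hp : 1/2 ≤ p) (hp1 : p < 1) (hη : 0 < η) (hε : 2 * η ≤ ε) (hlam : 0 < lam)
    (w : ℝ × (Fin d → ℝ))
    (hopt : ∀ w' : ℝ × (Fin d → ℝ),
      advSvmObj p η ε lam d w ≤ advSvmObj p η ε lam d w') :
    ∀ i : Fin d, w.2 i = 0 := by
  have h := hopt (w.1, 0)
  rw [svm_obj_eq, svm_obj_eq] at h
  have h1 := svm_cond p η ε d (-1) (by norm_num) hη hε w
  have h2 := svm_cond p η ε d 1 (by norm_num) hη hε w
  have h3 : lam / 2 * ∑ i, (w.2 i) ^ 2 ≤ 0 := by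
    simp only [Pi.zero_apply, ne_eq, OfNat.ofNat_ne_zero, not_false_eq_true, zero_pow,
      Finset.sum_const_zero] at h
    linarith
  have h4 : ∑ i, (w.2 i) ^ 2 ≤ 0 := by
    by_contra hc
    have := mul_pos (half_pos hlam) (not_le.mp hc)
    linarith
  intro i
  have h5 := Finset.single_le_sum (f := fun i => (w.2 i) ^ 2) (fun j _ => sq_nonneg _)
    (Finset.mem_univ i)
  have h6 : (w.2 i) ^ 2 = 0 := le_antisymm (h5.trans h4) (sq_nonneg _)
  exact pow_eq_zero_iff (two_ne_zero) |>.mp h6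
end
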